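/- Let ρ be a Hermitian d×d complex matrix, let G : ι×ι → ℂ satisfy G_{nn} = 1 for all n, and let A be any d×d complex matrix (an observable). Then the distinguishability of the partially dephased state from equilibrium by A obeys |tr[A · (𝒢_G(ρ) − 𝒟(ρ))]| ≤ (max_{n≠m} |G_{nm}|) · ‖A‖₂ · ‖ρ − 𝒟(ρ)‖₂. -/

import Mathlib

open Matrix BigOperators

/-- The Frobenius (Hilbert–Schmidt) norm `‖X‖₂ = √(tr(XᴴX))`. -/
noncomputable def frob {d : ℕ} (X : Matrix (Fin d) (Fin d) ℂ) : ℝ :=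
  Real.sqrt ((Xᴴ * X).trace.re)

/-- The dephasing map `𝒟(X) = Σ_n P_n X P_n`. -/
noncomputable def deph {d : ℕ} {ι : Type*} [Fintype ι]
    (P : ι → Matrix (Fin d) (Fin d) ℂ) (X : Matrix (Fin d) (Fin d) ℂ) :
    Matrix (Fin d) (Fin d) ℂ :=
  ∑ n, P n * X * P n

/-- The partial dephasing map `𝒢_G(X) = Σ_{n,m} G_{nm} P_n X P_m`. -/
noncomputable def pdeph {d : ℕ} {ι : Type*} [Fintype ι]
    (P : ι → Matrix (Fin d) (Fin d) ℂ) (G : ι → ι → ℂ)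
    (X : Matrix (Fin d) (Fin d) ℂ) : Matrix (Fin d) (Fin d) ℂ :=
  ∑ n, ∑ m, G n m • (P n * X * P m)

/-- `max_{n≠m} |G_{nm}|`, the maximum modulus of the off-diagonal coefficients. -/
noncomputable def maxOffDiag {ι : Type*} [Fintype ι] [DecidableEq ι] [Nontrivial ι]
    (G : ι → ι → ℂ) : ℝ :=
  Finset.univ.offDiag.sup'
    (by
      obtain ⟨a, b, hab⟩ := exists_pair_ne ι
      exact ⟨(a, b), Finset.mem_offDiag.mpr ⟨Finset.mem_univ _, Finset.mem_univ _, hab⟩⟩)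
    (fun p => ‖G p.1 p.2‖)

theorem trace_conjTranspose_mul_self_re {d : ℕ} (X : Matrix (Fin d) (Fin d) ℂ) :
    (Xᴴ * X).trace.re = ∑ p : Fin d × Fin d, ‖X p.1 p.2‖ ^ 2 := by
  rw [Fintype.sum_prod_type, Finset.sum_comm]
  simp only [Matrix.trace, Matrix.diag, Matrix.mul_apply, Matrix.conjTranspose_apply,
    Complex.re_sum]
  refine Finset.sum_congr rfl fun i _ => Finset.sum_congr rfl fun j _ => ?_
  rw [Complex.star_def, Complex.conj_mul']
  norm_cast

theorem frob_nonneg {d : ℕ} (X : Matrix (Fin d) (Fin d) ℂ) : 0 ≤ frob X :=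
  Real.sqrt_nonneg _

theorem frob_sq {d : ℕ} (X : Matrix (Fin d) (Fin d) ℂ) :
    frob X ^ 2 = (Xᴴ * X).trace.re := by
  refine Real.sq_sqrt ?_
  rw [trace_conjTranspose_mul_self_re]
  positivity

theorem frob_smul {d : ℕ} (c : ℂ) (X : Matrix (Fin d) (Fin d) ℂ) :
    frob (c • X) = ‖c‖ * frob X := by
  simp only [frob, trace_conjTranspose_mul_self_re, Matrix.smul_apply, smul_eq_mul, norm_mul,
    mul_pow, ← Finset.mul_sum]
  rw [Real.sqrt_mul (sq_nonneg _), Real.sqrt_sq (norm_nonneg _)]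

/-- The Cauchy–Schwarz inequality for the Hilbert–Schmidt pairing. -/
theorem norm_trace_mul_le_frob {d : ℕ} (A X : Matrix (Fin d) (Fin d) ℂ) :
    ‖(A * X).trace‖ ≤ frob A * frob X := by
  have hX : ∑ p : Fin d × Fin d, ‖X p.1 p.2‖ ^ 2 = ∑ p : Fin d × Fin d, ‖X p.2 p.1‖ ^ 2 :=
    (Equiv.sum_comp (Equiv.prodComm (Fin d) (Fin d)) fun p => ‖X p.1 p.2‖ ^ 2).symm
  have htr : (A * X).trace = ∑ p : Fin d × Fin d, A p.1 p.2 * X p.2 p.1 := by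
    simp only [Matrix.trace, Matrix.diag, Matrix.mul_apply, Fintype.sum_prod_type]
  rw [frob, frob, trace_conjTranspose_mul_self_re, trace_conjTranspose_mul_self_re, hX, htr]
  refine (norm_sum_le _ _).trans ?_
  simp only [norm_mul]
  exact Real.sum_mul_le_sqrt_mul_sqrt _ _ _

/-- Pythagoras for the block decomposition along a resolution of the identity. -/
theorem frob_sq_eq_sum_blocks {d : ℕ} {ι : Type*} [Fintype ι]
    (P : ι → Matrix (Fin d) (Fin d) ℂ) (hHerm : ∀ n, (P n)ᴴ = P n)
    (hIdem : ∀ n, P n * P n = P n) (hSum : ∑ n, P n = 1) (X : Matrix (Fin d) (Fin d) ℂ) :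
    frob X ^ 2 = ∑ n, ∑ m, frob (P n * X * P m) ^ 2 := by
  have hblock : ∀ n m, ((P n * X * P m)ᴴ * (P n * X * P m)).trace =
      (Xᴴ * P n * X * P m).trace := by
    intro n m
    calc ((P n * X * P m)ᴴ * (P n * X * P m)).trace
        = (P m * (Xᴴ * (P n * P n) * X * P m)).trace := by
          simp only [Matrix.conjTranspose_mul, hHerm, Matrix.mul_assoc]
      _ = (Xᴴ * P n * X * (P m * P m)).trace := by
          rw [Matrix.trace_mul_comm, hIdem]
          simp only [Matrix.mul_assoc]
      _ = (Xᴴ * P n * X * P m).trace := by rw [hIdem]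
  simp only [frob_sq, hblock, ← Complex.re_sum, ← Matrix.trace_sum, ← Matrix.mul_sum,
    ← Matrix.sum_mul, hSum, Matrix.mul_one]

theorem mul_pdeph_mul {d : ℕ} {ι : Type*} [Fintype ι] [DecidableEq ι]
    (P : ι → Matrix (Fin d) (Fin d) ℂ) (hOrth : ∀ n m, n ≠ m → P n * P m = 0)
    (hIdem : ∀ n, P n * P n = P n) (G : ι → ι → ℂ) (X : Matrix (Fin d) (Fin d) ℂ) (n m : ι) :
    P n * pdeph P G X * P m = G n m • (P n * X * P m) := by
  have hterm : ∀ k l, P n * (P k * X * P l) * P m =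
      if k = n then if l = m then P n * X * P m else 0 else 0 := by
    intro k l
    rw [show P n * (P k * X * P l) * P m = P n * P k * X * (P l * P m) by
      simp only [Matrix.mul_assoc]]
    split_ifs with hk hl
    · rw [hk, hl, hIdem, hIdem]
    · rw [hOrth l m hl, Matrix.mul_zero]
    · rw [hOrth n k (Ne.symm hk), Matrix.zero_mul, Matrix.zero_mul]
  simp [pdeph, Matrix.mul_sum, Matrix.sum_mul, hterm]

theorem deph_eq_pdeph {d : ℕ} {ι : Type*} [Fintype ι] [DecidableEq ι]
    (P : ι → Matrix (Fin d) (Fin d) ℂ) (X : Matrix (Fin d) (Fin d) ℂ) :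
    deph P X = pdeph P (fun n m => if n = m then 1 else 0) X := by
  simp [deph, pdeph, ite_smul]

theorem norm_le_maxOffDiag {ι : Type*} [Fintype ι] [DecidableEq ι] [Nontrivial ι]
    (G : ι → ι → ℂ) {n m : ι} (h : n ≠ m) : ‖G n m‖ ≤ maxOffDiag G := by
  have hmem : (n, m) ∈ (Finset.univ : Finset ι).offDiag := by simpa using h
  exact Finset.le_sup' (fun p : ι × ι => ‖G p.1 p.2‖) hmem

theorem maxOffDiag_nonneg {ι : Type*} [Fintype ι] [DecidableEq ι] [Nontrivial ι]
    (G : ι → ι → ℂ) : 0 ≤ maxOffDiag G := by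
  obtain ⟨a, b, hab⟩ := exists_pair_ne ι
  exact (norm_nonneg _).trans (norm_le_maxOffDiag G hab)

theorem frob_pdeph_sub_deph_le {d : ℕ} {ι : Type*} [Fintype ι] [DecidableEq ι] [Nontrivial ι]
    (P : ι → Matrix (Fin d) (Fin d) ℂ) (hHerm : ∀ n, (P n)ᴴ = P n)
    (hOrth : ∀ n m, n ≠ m → P n * P m = 0) (hIdem : ∀ n, P n * P n = P n)
    (hSum : ∑ n, P n = 1) (G : ι → ι → ℂ) (hG : ∀ n, G n n = 1)
    (X : Matrix (Fin d) (Fin d) ℂ) :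
    frob (pdeph P G X - deph P X) ≤ maxOffDiag G * frob (X - deph P X) := by
  have hblock : ∀ n m, frob (P n * (pdeph P G X - deph P X) * P m) ≤
      maxOffDiag G * frob (P n * (X - deph P X) * P m) := by
    intro n m
    simp only [Matrix.mul_sub, Matrix.sub_mul, deph_eq_pdeph, mul_pdeph_mul P hOrth hIdem]
    by_cases h : n = m
    · subst h
      simp [hG, frob]
    · simp only [h, if_false, zero_smul, sub_zero, frob_smul]
      exact mul_le_mul_of_nonneg_right (norm_le_maxOffDiag G h) (frob_nonneg _)
  refine (pow_le_pow_iff_left₀ (frob_nonneg _) (mul_nonneg (maxOffDiag_nonneg G) (frob_nonneg _))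
    two_ne_zero).mp ?_
  rw [mul_pow, frob_sq_eq_sum_blocks P hHerm hIdem hSum (pdeph P G X - deph P X),
    frob_sq_eq_sum_blocks P hHerm hIdem hSum (X - deph P X)]
  simp only [Finset.mul_sum, ← mul_pow]
  exact Finset.sum_le_sum fun n _ => Finset.sum_le_sum fun m _ =>
    pow_le_pow_left₀ (frob_nonneg _) (hblock n m) 2

/-- for Hermitian `ρ`, coefficients `G` with unit diagonal, and any
observable `A`, `|tr[A(𝒢_G(ρ) − 𝒟(ρ))]| ≤ (max_{n≠m} |G_{nm}|) ‖A‖₂ ‖ρ − 𝒟(ρ)‖₂`,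
where `ω = 𝒟(ρ)` is the equilibrium state. -/
theorem observable_distinguishability_bound {d : ℕ} {ι : Type*}
    [Fintype ι] [DecidableEq ι] [Nontrivial ι]
    (P : ι → Matrix (Fin d) (Fin d) ℂ)
    (hHerm : ∀ n, (P n)ᴴ = P n)
    (hOrth : ∀ n m, n ≠ m → P n * P m = 0)
    (hIdem : ∀ n, P n * P n = P n)
    (hSum : ∑ n, P n = 1)
    (ρ : Matrix (Fin d) (Fin d) ℂ) (hρ : ρᴴ = ρ)
    (G : ι → ι → ℂ) (hG : ∀ n, G n n = 1)
    (A : Matrix (Fin d) (Fin d) ℂ) :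
    ‖(A * (pdeph P G ρ - deph P ρ)).trace‖ ≤
      maxOffDiag G * frob A * frob (ρ - deph P ρ) := by
  calc ‖(A * (pdeph P G ρ - deph P ρ)).trace‖
      ≤ frob A * frob (pdeph P G ρ - deph P ρ) := norm_trace_mul_le_frob _ _
    _ ≤ frob A * (maxOffDiag G * frob (ρ - deph P ρ)) :=
        mul_le_mul_of_nonneg_left
          (frob_pdeph_sub_deph_le P hHerm hOrth hIdem hSum G hG ρ) (frob_nonneg A)
    _ = maxOffDiag G * frob A * frob (ρ - deph P ρ) := by ring
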